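/- Let p, n be positive integers, let ξ : ℝ^p → ℝ^n be twice continuously differentiable with Jacobian J(θ), and suppose θ* ∈ ℝ^p satisfies ξ(θ*) = 0 and J(θ*) is injective (full column rank). Fix γ ∈ (0,1) and define, wherever H(θ) := J(θ)ᵀ J(θ) is invertible, T_GN(θ) := θ − γ · H(θ)⁻¹ J(θ)ᵀ ξ(θ). Then there exist ε > 0 and ρ ∈ (0,1) such that H(θ) is invertible for every θ in the closed ball B of radius ε around θ*, and T_GN is ρ-Lipschitz on B: ‖T_GN(x) − T_GN(y)‖ ≤ ρ ‖x − y‖ for all x, y ∈ B. -/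

import Mathlib

open ContinuousLinearMap

/-- The Gauss–Newton curvature `H(θ) = J(θ)ᵀ J(θ)` of a residual map `ξ`, where
`J(θ) = Dξ(θ)` is the Fréchet derivative (Jacobian) of `ξ` at `θ`. -/
noncomputable def gnCurvature {p n : ℕ}
    (ξ : EuclideanSpace ℝ (Fin p) → EuclideanSpace ℝ (Fin n))
    (θ : EuclideanSpace ℝ (Fin p)) :
    EuclideanSpace ℝ (Fin p) →L[ℝ] EuclideanSpace ℝ (Fin p) :=
  (ContinuousLinearMap.adjoint (fderiv ℝ ξ θ)).comp (fderiv ℝ ξ θ)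

/-- The damped Gauss–Newton map `T_GN(θ) = θ − γ H(θ)⁻¹ J(θ)ᵀ ξ(θ)`; the inverse is
`Ring.inverse`, which equals the true inverse wherever `H(θ)` is invertible. -/
noncomputable def dampedGN {p n : ℕ}
    (ξ : EuclideanSpace ℝ (Fin p) → EuclideanSpace ℝ (Fin n)) (γ : ℝ)
    (θ : EuclideanSpace ℝ (Fin p)) : EuclideanSpace ℝ (Fin p) :=
  θ - γ • (Ring.inverse (gnCurvature ξ θ)) (ContinuousLinearMap.adjoint (fderiv ℝ ξ θ) (ξ θ))

theorem contDiff_clm_adjoint {p n : ℕ} {k : WithTop ℕ∞} :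
    ContDiff ℝ k (fun A : EuclideanSpace ℝ (Fin p) →L[ℝ] EuclideanSpace ℝ (Fin n) =>
      ContinuousLinearMap.adjoint A) :=
  IsBoundedLinearMap.contDiff
    { map_add := fun A B => map_add _ A B
      map_smul := fun c A => by simp
      bound := ⟨1, one_pos, fun A => by simp⟩ }

theorem contDiff_gnCurvature {p n : ℕ}
    {ξ : EuclideanSpace ℝ (Fin p) → EuclideanSpace ℝ (Fin n)} (hξ : ContDiff ℝ 2 ξ) :
    ContDiff ℝ 1 (gnCurvature ξ) := by
  have hJ : ContDiff ℝ 1 (fderiv ℝ ξ) := hξ.fderiv_right (by norm_num)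
  exact (contDiff_clm_adjoint.comp hJ).clm_comp hJ

theorem isUnit_gnCurvature {p n : ℕ}
    {ξ : EuclideanSpace ℝ (Fin p) → EuclideanSpace ℝ (Fin n)} {θ : EuclideanSpace ℝ (Fin p)}
    (hinj : Function.Injective (fderiv ℝ ξ θ)) : IsUnit (gnCurvature ξ θ) := by
  have hH : Function.Injective (gnCurvature ξ θ) := by
    refine (injective_iff_map_eq_zero _).2 fun v hv => (injective_iff_map_eq_zero _).1 hinj v ?_
    have h := ContinuousLinearMap.apply_norm_sq_eq_inner_adjoint_left (fderiv ℝ ξ θ) v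
    have h' : (adjoint (fderiv ℝ ξ θ) ∘L fderiv ℝ ξ θ) v = 0 := hv
    simpa [h'] using h
  exact ContinuousLinearMap.isUnit_iff_bijective.2
    ⟨hH, LinearMap.injective_iff_surjective (f := (gnCurvature ξ θ).toLinearMap) |>.1 hH⟩

/-- At a regular zero-residual point the damped Gauss–Newton map is strictly differentiable, with
derivative `(1 - γ) I`. -/
theorem hasStrictFDerivAt_dampedGN {p n : ℕ}
    {ξ : EuclideanSpace ℝ (Fin p) → EuclideanSpace ℝ (Fin n)} (hξ : ContDiff ℝ 2 ξ)
    {θ : EuclideanSpace ℝ (Fin p)} (hzero : ξ θ = 0)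
    (hinj : Function.Injective (fderiv ℝ ξ θ)) (γ : ℝ) :
    HasStrictFDerivAt (dampedGN ξ γ)
      ((1 - γ) • ContinuousLinearMap.id ℝ (EuclideanSpace ℝ (Fin p))) θ := by
  have hH := isUnit_gnCurvature hinj
  have hJ : ContDiff ℝ 1 (fderiv ℝ ξ) := hξ.fderiv_right (by norm_num)
  have hinv : ContDiffAt ℝ 1 (fun x => Ring.inverse (gnCurvature ξ x)) θ := by
    obtain ⟨u, hu⟩ := hH
    have h := contDiffAt_ringInverse ℝ (n := 1) u
    rw [hu] at h
    exact h.comp θ (contDiff_gnCurvature hξ).contDiffAt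
  have hG : ContDiffAt ℝ 1
      (fun x => (Ring.inverse (gnCurvature ξ x)) ∘L adjoint (fderiv ℝ ξ x)) θ :=
    hinv.clm_comp (contDiff_clm_adjoint.comp hJ).contDiffAt
  have hstep := (hG.hasStrictFDerivAt one_ne_zero).clm_apply
    (hξ.contDiffAt.hasStrictFDerivAt two_ne_zero)
  refine ((hasStrictFDerivAt_id θ).sub (hstep.const_smul γ)).congr_fderiv ?_
  ext1 v
  have hcancel := DFunLike.congr_fun (Ring.inverse_mul_cancel _ hH) v
  have hcancel' : Ring.inverse (gnCurvature ξ θ) (adjoint (fderiv ℝ ξ θ) (fderiv ℝ ξ θ v)) = v :=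
    hcancel
  simp [hzero, hcancel', sub_smul]

/-- Local contraction of the damped Gauss–Newton operator in the
zero-residual regular regime: if `ξ` is `C²`, `ξ(θ*) = 0` and `J(θ*)` is injective,
then for some `ε > 0` and `ρ ∈ (0,1)`, `H(θ)` is invertible on the closed `ε`-ball `B`
around `θ*` and `T_GN` is `ρ`-Lipschitz on `B`. -/
theorem dampedGN_local_contraction
    (p n : ℕ) (hp : 0 < p) (hn : 0 < n)
    (ξ : EuclideanSpace ℝ (Fin p) → EuclideanSpace ℝ (Fin n))
    (hξ : ContDiff ℝ 2 ξ)
    (θs : EuclideanSpace ℝ (Fin p))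
    (hzero : ξ θs = 0)
    (hinj : Function.Injective (fderiv ℝ ξ θs))
    (γ : ℝ) (hγ : γ ∈ Set.Ioo (0 : ℝ) 1) :
    ∃ ε > (0 : ℝ), ∃ ρ ∈ Set.Ioo (0 : ℝ) 1,
      (∀ θ ∈ Metric.closedBall θs ε, IsUnit (gnCurvature ξ θ)) ∧
      ∀ x ∈ Metric.closedBall θs ε, ∀ y ∈ Metric.closedBall θs ε,
        ‖dampedGN ξ γ x - dampedGN ξ γ y‖ ≤ ρ * ‖x - y‖ := by
  obtain ⟨hγ0, hγ1⟩ := hγ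
  let K : NNReal := ⟨1 - γ / 2, by linarith⟩
  have hK : ‖(1 - γ) • ContinuousLinearMap.id ℝ (EuclideanSpace ℝ (Fin p))‖₊ < K := by
    rw [← NNReal.coe_lt_coe, coe_nnnorm]
    refine (ContinuousLinearMap.opNorm_le_bound _ (sub_nonneg.2 hγ1.le) fun v => ?_).trans_lt
      (show 1 - γ < 1 - γ / 2 by linarith)
    simp [norm_smul, abs_of_pos (sub_pos.2 hγ1)]
  obtain ⟨s, hs, hLip⟩ :=
    (hasStrictFDerivAt_dampedGN hξ hzero hinj γ).exists_lipschitzOnWith_of_nnnorm_lt K hK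
  have hunit : ∀ᶠ θ in nhds θs, IsUnit (gnCurvature ξ θ) :=
    (contDiff_gnCurvature hξ).continuous.continuousAt.eventually
      (Units.isOpen.mem_nhds (isUnit_gnCurvature hinj))
  obtain ⟨ε, hε, hball⟩ := Metric.nhds_basis_closedBall.mem_iff.1 (Filter.inter_mem hs hunit)
  refine ⟨ε, hε, 1 - γ / 2, ⟨by linarith, by linarith⟩, fun θ hθ => (hball hθ).2,
    fun x hx y hy => ?_⟩
  exact hLip.norm_sub_le (hball hx).1 (hball hy).1
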